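/- Let E be a real normed vector space, I a finite type with card I = N, and C : I → Set E a (δ, Δ)-separated family of nonempty subsets with Δ > 3δ. Let K : Fin m → E be a family of prompt keys with labels κ : Fin m → I such that K k ∈ convexHull ℝ (C (κ k)) for every k, and suppose m > N. Then for any pair of indices a ≠ b that minimizes the distance among distinct pairs, i.e. such that ‖K a − K b‖ ≤ ‖K a' − K b'‖ for all a' ≠ b', one has κ a = κ b. (Lemma 2: when the prompt pool is full, the closest-pair fusion step of Knowledge Fusion always merges two prompts representing the same cluster.) -/

import Mathlib

/-- Points in the convex hull of a set whose points are pairwise within `δ` are within `δ`. -/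
theorem norm_sub_le_of_mem_convexHull
    {E : Type*} [NormedAddCommGroup E] [NormedSpace ℝ E] {s : Set E} {δ : ℝ}
    (hs : ∀ a ∈ s, ∀ a' ∈ s, ‖a - a'‖ ≤ δ) {x y : E}
    (hx : x ∈ convexHull ℝ s) (hy : y ∈ convexHull ℝ s) : ‖x - y‖ ≤ δ := by
  obtain ⟨x', hx', y', hy', h⟩ := convexHull_exists_dist_ge2 hx hy
  rw [dist_eq_norm, dist_eq_norm] at h
  exact h.trans (hs x' hx' y' hy')

/-- Lemma 2: when the prompt pool is full, the closest-pair
fusion step of Knowledge Fusion always merges two prompts representing the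
same cluster. -/
theorem closest_pair_fusion_same_cluster
    {E : Type*} [NormedAddCommGroup E] [NormedSpace ℝ E]
    {I : Type*} [Fintype I] (N : ℕ) (hcard : Fintype.card I = N)
    (C : I → Set E) (δ Δ : ℝ)
    (hδ : 0 ≤ δ) (hΔ : 0 < Δ) (hΔδ : Δ > 3 * δ)
    (hne : ∀ i, (C i).Nonempty)
    (hintra : ∀ i, ∀ a ∈ C i, ∀ a' ∈ C i, ‖a - a'‖ ≤ δ)
    (hinter : ∀ i j, i ≠ j → ∀ a ∈ C i, ∀ b ∈ C j, Δ ≤ ‖a - b‖)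
    {m : ℕ} (K : Fin m → E) (κ : Fin m → I)
    (hK : ∀ k, K k ∈ convexHull ℝ (C (κ k)))
    (hm : m > N)
    {a b : Fin m} (hab : a ≠ b)
    (hmin : ∀ a' b' : Fin m, a' ≠ b' → ‖K a - K b‖ ≤ ‖K a' - K b'‖) :
    κ a = κ b := by
  by_contra hne_label
  obtain ⟨i, j, hij, hlabel⟩ := Fintype.exists_ne_map_eq_of_card_lt κ (by simp; omega)
  have hle : ‖K a - K b‖ ≤ δ := (hmin i j hij).trans <|
    norm_sub_le_of_mem_convexHull (hintra (κ i)) (hK i) (hlabel ▸ hK j)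
  obtain ⟨x, hx⟩ := hne (κ a)
  obtain ⟨y, hy⟩ := hne (κ b)
  have hxa : ‖x - K a‖ ≤ δ :=
    norm_sub_le_of_mem_convexHull (hintra (κ a)) (subset_convexHull ℝ _ hx) (hK a)
  have hby : ‖K b - y‖ ≤ δ :=
    norm_sub_le_of_mem_convexHull (hintra (κ b)) (hK b) (subset_convexHull ℝ _ hy)
  have hxy := hinter (κ a) (κ b) hne_label x hx y hy
  have hxb := norm_sub_le_norm_sub_add_norm_sub x (K a) (K b)
  have hxby := norm_sub_le_norm_sub_add_norm_sub x (K b) y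
  linarith
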